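/- arXiv:1405.6229 — 2 statements merged into one kernel-verified Lean document; each statement's English description precedes it below -/
import Mathlib

section
/- Let p ∈ (1, 2], q = p/(p-1), and let φ, ψ ∈ L^p(μ). Then 2(‖φ‖_p^p + ‖ψ‖_p^p)^(q/p) ≥ ‖φ+ψ‖_p^q + ‖φ-ψ‖_p^q. -/
open MeasureTheory

theorem one_add_rpow_add_one_sub_rpow_le {p q z : ℝ} (hpq : p.HolderConjugate q) (hp2 : p ≤ 2)
    (hz0 : 0 < z) (hz1 : z ≤ 1) :
    (1 + z) ^ q + (1 - z) ^ q ≤ 2 * (1 + z ^ p) ^ (q - 1) := by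
  have hp1 := hpq.lt
  have hq1 := hpq.symm.lt
  have hmul : (p - 1) * (q - 1) = 1 := by linear_combination hpq.mul_eq_add
  have hq2 : 2 ≤ q := by nlinarith
  set F : ℝ → ℝ := fun t => (1 + t ^ (1 - q) * z) * (1 + t * z) ^ (q - 1)
    + (1 - t ^ (1 - q) * z) * (1 - t * z) ^ (q - 1) with hF
  have ha0 : 0 < z ^ (p - 1) := Real.rpow_pos_of_pos hz0 _
  have ha1 : z ^ (p - 1) ≤ 1 := Real.rpow_le_one hz0.le hz1 (by linarith)
  have hcont : ContinuousOn F (Set.Icc (z ^ (p - 1)) 1) := by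
    have h1 : ContinuousOn (fun t : ℝ => t ^ (1 - q)) (Set.Icc (z ^ (p - 1)) 1) :=
      continuousOn_id.rpow_const fun t ht => Or.inl (ha0.trans_le ht.1).ne'
    have h2 : Continuous fun t : ℝ => (1 + t * z) ^ (q - 1) :=
      (by fun_prop : Continuous fun t : ℝ => 1 + t * z).rpow_const fun _ => Or.inr (by linarith)
    have h3 : Continuous fun t : ℝ => (1 - t * z) ^ (q - 1) :=
      (by fun_prop : Continuous fun t : ℝ => 1 - t * z).rpow_const fun _ => Or.inr (by linarith)
    exact ((continuousOn_const.add (h1.mul continuousOn_const)).mul h2.continuousOn).add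
      ((continuousOn_const.sub (h1.mul continuousOn_const)).mul h3.continuousOn)
  have hderiv : ∀ t ∈ Set.Ioo (z ^ (p - 1)) 1, HasDerivAt F
      ((q - 1) * z * (1 - t ^ (-q)) * ((1 + t * z) ^ (q - 2) - (1 - t * z) ^ (q - 2))) t := by
    intro t ht
    have ht0 : 0 < t := ha0.trans ht.1
    have htz : t * z < 1 := by nlinarith [ht.2]
    have hpos : 0 < 1 + t * z := by positivity
    have hneg : 0 < 1 - t * z := by linarith
    have h1 : HasDerivAt (fun t : ℝ => t ^ (1 - q) * z) ((1 - q) * t ^ (-q) * z) t := by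
      have := (Real.hasDerivAt_rpow_const (p := 1 - q) (Or.inl ht0.ne')).mul_const z
      rwa [show 1 - q - 1 = -q by ring] at this
    have h2 : HasDerivAt (fun t : ℝ => t * z) z t := hasDerivAt_mul_const z
    have h3 := (h2.const_add 1).rpow_const (p := q - 1) (Or.inl hpos.ne')
    have h4 := (h2.const_sub 1).rpow_const (p := q - 1) (Or.inl hneg.ne')
    have e1 : t ^ (1 - q) = t * t ^ (-q) := by
      rw [sub_eq_add_neg, Real.rpow_add ht0, Real.rpow_one]
    have e2 : (1 + t * z) ^ (q - 1) = (1 + t * z) * (1 + t * z) ^ (q - 2) := by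
      rw [show q - 1 = 1 + (q - 2) by ring, Real.rpow_add hpos, Real.rpow_one]
    have e3 : (1 - t * z) ^ (q - 1) = (1 - t * z) * (1 - t * z) ^ (q - 2) := by
      rw [show q - 1 = 1 + (q - 2) by ring, Real.rpow_add hneg, Real.rpow_one]
    refine (((h1.const_add 1).mul h3).add ((h1.const_sub 1).mul h4)).congr_deriv ?_
    rw [show q - 1 - 1 = q - 2 by ring, e1, e2, e3]
    ring
  have hanti : AntitoneOn F (Set.Icc (z ^ (p - 1)) 1) := by
    refine antitoneOn_of_hasDerivWithinAt_nonpos (convex_Icc _ _) hcont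
      (fun t ht => (hderiv t (by simpa using ht)).hasDerivWithinAt) fun t ht => ?_
    rw [interior_Icc] at ht
    have ht0 : 0 < t := ha0.trans ht.1
    have htz : t * z < 1 := by nlinarith [ht.2]
    have h1 : 1 ≤ t ^ (-q) :=
      Real.one_le_rpow_of_pos_of_le_one_of_nonpos ht0 ht.2.le (by linarith)
    have h2 : (1 - t * z) ^ (q - 2) ≤ (1 + t * z) ^ (q - 2) :=
      Real.rpow_le_rpow (by linarith) (by nlinarith) (by linarith)
    exact mul_nonpos_of_nonpos_of_nonneg (mul_nonpos_of_nonneg_of_nonpos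
      (mul_nonneg (by linarith) hz0.le) (by linarith)) (by linarith)
  have key := hanti ⟨le_rfl, ha1⟩ ⟨ha1, le_rfl⟩ ha1
  have e1 : (z ^ (p - 1)) ^ (1 - q) * z = 1 := by
    rw [← Real.rpow_mul hz0.le, show (p - 1) * (1 - q) = -1 by linear_combination -hmul,
      Real.rpow_neg_one, inv_mul_cancel₀ hz0.ne']
  have e2 : z ^ (p - 1) * z = z ^ p := by
    rw [← Real.rpow_add_one hz0.ne', sub_add_cancel]
  have e3 : ∀ y : ℝ, 0 ≤ y → y * y ^ (q - 1) = y ^ q := fun y hy => by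
    rw [mul_comm, ← Real.rpow_add_one' hy (by linarith), sub_add_cancel]
  simp only [hF, e1, e2, Real.one_rpow, one_mul, sub_self, zero_mul, add_zero] at key
  rw [e3 _ (by linarith), e3 _ (by linarith)] at key
  linarith

theorem abs_add_rpow_add_abs_sub_rpow_le {p q : ℝ} (hpq : p.HolderConjugate q) (hp2 : p ≤ 2)
    (a b : ℝ) :
    |a + b| ^ q + |a - b| ^ q ≤ 2 * (|a| ^ p + |b| ^ p) ^ (q / p) := by
  have hp0 := hpq.pos
  have hq0 := hpq.symm.pos
  have hqp : q / p = q - 1 := by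
    rw [div_eq_iff hp0.ne']; linear_combination -hpq.mul_eq_add
  have main : ∀ a b : ℝ, 0 ≤ b → b ≤ a →
      (a + b) ^ q + (a - b) ^ q ≤ 2 * (a ^ p + b ^ p) ^ (q / p) := by
    intro a b hb hab
    have hpow : (a ^ p) ^ (q / p) = a ^ q := by
      rw [← Real.rpow_mul (hb.trans hab), mul_div_cancel₀ _ hp0.ne']
    rcases hb.eq_or_lt with rfl | hb
    · simp [Real.zero_rpow hp0.ne', hpow, two_mul]
    have ha : 0 < a := hb.trans_le hab
    have hz1 : b / a ≤ 1 := (div_le_one ha).2 hab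
    have h := one_add_rpow_add_one_sub_rpow_le hpq hp2 (div_pos hb ha) hz1
    have e : b = a * (b / a) := by field_simp
    generalize b / a = z at h hz1 e
    have hz0 : 0 < z := by
      rw [e] at hb; exact pos_of_mul_pos_right hb ha.le
    rw [e, show a + a * z = a * (1 + z) by ring, show a - a * z = a * (1 - z) by ring,
      Real.mul_rpow ha.le (by linarith), Real.mul_rpow ha.le (by linarith),
      Real.mul_rpow ha.le hz0.le, show a ^ p + a ^ p * z ^ p = a ^ p * (1 + z ^ p) by ring,
      Real.mul_rpow (by positivity) (by positivity), hpow, hqp]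
    nlinarith [Real.rpow_pos_of_pos ha q]
  have habs : ∀ a b : ℝ, |b| ≤ |a| →
      |a + b| ^ q + |a - b| ^ q ≤ 2 * (|a| ^ p + |b| ^ p) ^ (q / p) := by
    intro a b hab
    refine le_of_eq_of_le ?_ (main |a| |b| (abs_nonneg b) hab)
    rw [← abs_of_nonneg (sub_nonneg.2 hab),
      ← abs_of_nonneg (add_nonneg (abs_nonneg a) (abs_nonneg b))]
    rcases abs_choice a with ha | ha <;> rcases abs_choice b with hb | hb <;> rw [ha, hb]
    · rw [← sub_eq_add_neg, sub_neg_eq_add, add_comm]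
    · rw [← abs_neg (-a + b), ← abs_neg (-a - b), add_comm]; ring_nf
    · rw [← abs_neg (-a + -b), ← abs_neg (-a - -b)]; ring_nf
  rcases le_total |b| |a| with h | h
  · exact habs a b h
  · rw [add_comm a b, abs_sub_comm a b, add_comm (|a| ^ p)]
    exact habs b a h

theorem integral_rpow_add_integral_rpow_le {X : Type*} [MeasurableSpace X] {μ : Measure X}
    {r c : ℝ} (hr : 1 ≤ r) (hc : 0 ≤ c) {u v w : X → ℝ} (hu : Integrable u μ)
    (hv : Integrable v μ) (hw : Integrable w μ) (hw0 : 0 ≤ᵐ[μ] w)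
    (h : ∀ᵐ x ∂μ, |u x| ^ r + |v x| ^ r ≤ c * w x ^ r) :
    |∫ x, u x ∂μ| ^ r + |∫ x, v x ∂μ| ^ r ≤ c * (∫ x, w x ∂μ) ^ r := by
  have hr0 : 0 < r := by linarith
  have : Fact (1 ≤ ENNReal.ofReal r) := ⟨by simpa using hr⟩
  have hnorm : ∀ y : WithLp (ENNReal.ofReal r) (ℝ × ℝ),
      ‖y‖ = (|y.fst| ^ r + |y.snd| ^ r) ^ (1 / r) := fun y => by
    rw [WithLp.prod_norm_eq_add (by simpa [hr0.le] using hr0), ENNReal.toReal_ofReal hr0.le]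
    rfl
  let L := (WithLp.prodContinuousLinearEquiv (ENNReal.ofReal r) ℝ ℝ ℝ).symm
  have hint : ∫ x, L (u x, v x) ∂μ = L (∫ x, u x ∂μ, ∫ x, v x ∂μ) := by
    rw [L.integral_comp_comm, integral_pair hu hv]
  have hle : ‖∫ x, L (u x, v x) ∂μ‖ ≤ ∫ x, c ^ (1 / r) * w x ∂μ := by
    refine norm_integral_le_of_norm_le (hw.const_mul _) ?_
    filter_upwards [h, hw0] with x hx hwx
    rw [hnorm]
    refine (Real.rpow_le_rpow (by positivity) hx (by positivity)).trans_eq ?_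
    rw [Real.mul_rpow hc (Real.rpow_nonneg hwx r), ← Real.rpow_mul hwx, mul_one_div_cancel hr0.ne',
      Real.rpow_one]
  rw [hint, hnorm, integral_const_mul] at hle
  have := Real.rpow_le_rpow (by positivity) hle hr0.le
  rwa [Real.mul_rpow (by positivity) (integral_nonneg_of_ae hw0), ← Real.rpow_mul (by positivity),
    ← Real.rpow_mul hc, one_div_mul_cancel hr0.ne', Real.rpow_one, Real.rpow_one] at this

theorem Lp_norm_rpow_eq_integral {X E : Type*} [MeasurableSpace X] {μ : Measure X}
    [NormedAddCommGroup E] {p : ℝ} (hp : 0 < p) (f : Lp E (ENNReal.ofReal p) μ) :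
    ‖f‖ ^ p = ∫ x, ‖f x‖ ^ p ∂μ := by
  have h0 : 0 ≤ ∫ x, ‖f x‖ ^ p ∂μ := integral_nonneg fun x => by positivity
  rw [Lp.norm_def, (Lp.memLp f).eLpNorm_eq_integral_rpow_norm (by simpa using hp)
    ENNReal.ofReal_ne_top, ENNReal.toReal_ofReal hp.le, ENNReal.toReal_ofReal (by positivity),
    Real.rpow_inv_rpow h0 hp.ne']

theorem clarkson_second_Lp {X : Type*} [MeasurableSpace X] (μ : Measure X)
    (p : ℝ) (hp1 : 1 < p) (hp2 : p ≤ 2) (q : ℝ) (hq : q = p / (p - 1))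
    (φ ψ : Lp ℝ (ENNReal.ofReal p) μ) :
    ‖φ + ψ‖ ^ q + ‖φ - ψ‖ ^ q ≤ 2 * (‖φ‖ ^ p + ‖ψ‖ ^ p) ^ (q / p) := by
  have hpq : p.HolderConjugate q := (Real.holderConjugate_iff_eq_conjExponent hp1).2 hq
  have hp0 : 0 < p := hpq.pos
  have hr : 1 ≤ q / p := by
    rw [one_le_div hp0]
    nlinarith [hpq.mul_eq_add, hpq.symm.lt]
  have hint : ∀ f : Lp ℝ (ENNReal.ofReal p) μ, Integrable (fun x => ‖f x‖ ^ p) μ := fun f => by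
    simpa [hp0.le] using
      (Lp.memLp f).integrable_norm_rpow (by simpa using hp0) ENNReal.ofReal_ne_top
  have hpow : ∀ y : ℝ, 0 ≤ y → |y ^ p| ^ (q / p) = y ^ q := fun y hy => by
    rw [abs_of_nonneg (by positivity), ← Real.rpow_mul hy, mul_div_cancel₀ _ hp0.ne']
  have hnn : ∀ f : Lp ℝ (ENNReal.ofReal p) μ, 0 ≤ ‖f‖ := fun f => by
    rw [Lp.norm_def]
    exact ENNReal.toReal_nonneg
  have key := integral_rpow_add_integral_rpow_le hr zero_le_two (hint (φ + ψ)) (hint (φ - ψ))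
    ((hint φ).add (hint ψ)) (Filter.Eventually.of_forall fun x => by
      simp only [Pi.zero_apply, Pi.add_apply]; positivity) (by
      filter_upwards [Lp.coeFn_add φ ψ, Lp.coeFn_sub φ ψ] with x h1 h2
      rw [hpow _ (norm_nonneg _), hpow _ (norm_nonneg _), h1, h2]
      exact abs_add_rpow_add_abs_sub_rpow_le hpq hp2 (φ x) (ψ x))
  rwa [integral_add' (hint φ) (hint ψ), ← Lp_norm_rpow_eq_integral hp0,
    ← Lp_norm_rpow_eq_integral hp0, ← Lp_norm_rpow_eq_integral hp0,
    ← Lp_norm_rpow_eq_integral hp0, hpow _ (hnn (φ + ψ)), hpow _ (hnn (φ - ψ))] at key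
end

section
/- Let p ∈ [2, ∞) and φ, ψ ∈ L^p(μ). Then (‖φ‖_p + ‖ψ‖_p)^p + |‖φ‖_p - ‖ψ‖_p|^p ≥ ‖φ+ψ‖_p^p + ‖φ-ψ‖_p^p. -/
open MeasureTheory

/-- The coefficient of `|x| ^ p` in the tangent-line form of Hanner's inequality. -/
noncomputable def hannerAlpha (p r : ℝ) : ℝ := (1 + r) ^ (p - 1) + (1 - r) ^ (p - 1)

/-- The coefficient of `|y| ^ p` in the tangent-line form of Hanner's inequality. -/
noncomputable def hannerBeta (p r : ℝ) : ℝ :=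
  ((1 + r) ^ (p - 1) - (1 - r) ^ (p - 1)) * r ^ (1 - p)

theorem hannerAlpha_add_hannerBeta_mul_rpow_self {p r : ℝ} (hr : 0 < r) (hr1 : r ≤ 1)
    (hp : 2 ≤ p) :
    hannerAlpha p r + hannerBeta p r * r ^ p = (1 + r) ^ p + (1 - r) ^ p := by
  have h1 : r ^ (1 - p) * r ^ p = r := by rw [← Real.rpow_add hr]; simp
  have h2 : (1 + r) ^ p = (1 + r) ^ (p - 1) * (1 + r) := by
    rw [← Real.rpow_add_one' (by linarith) (by linarith)]; simp
  have h3 : (1 - r) ^ p = (1 - r) ^ (p - 1) * (1 - r) := by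
    rw [← Real.rpow_add_one' (by linarith) (by linarith)]; simp
  rw [hannerAlpha, hannerBeta, mul_assoc, h1, h2, h3]
  ring

theorem hasDerivAt_hannerAlpha_add_hannerBeta_mul {p r : ℝ} (R : ℝ) (hr : 0 < r)
    (hr1 : r < 1) :
    HasDerivAt (fun s => hannerAlpha p s + hannerBeta p s * R ^ p)
      ((p - 1) * ((1 + r) ^ (p - 2) - (1 - r) ^ (p - 2)) * (1 - R ^ p * r ^ (-p))) r := by
  have h1 : HasDerivAt (fun s : ℝ => (1 + s) ^ (p - 1)) (1 * (p - 1) * (1 + r) ^ (p - 1 - 1)) r :=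
    ((hasDerivAt_id r).const_add 1).rpow_const (Or.inl (by simp; linarith))
  have h2 : HasDerivAt (fun s : ℝ => (1 - s) ^ (p - 1))
      (-1 * (p - 1) * (1 - r) ^ (p - 1 - 1)) r :=
    ((hasDerivAt_id r).const_sub 1).rpow_const (Or.inl (by simp; linarith))
  have h3 : HasDerivAt (fun s : ℝ => s ^ (1 - p)) ((1 - p) * r ^ (1 - p - 1)) r :=
    Real.hasDerivAt_rpow_const (Or.inl hr.ne')
  refine ((h1.add h2).add (((h1.sub h2).mul h3).mul_const (R ^ p))).congr_deriv ?_
  have e1 : (1 + r) ^ (p - 1) = (1 + r) ^ (p - 2) * (1 + r) := by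
    rw [← Real.rpow_add_one (by linarith)]; ring_nf
  have e2 : (1 - r) ^ (p - 1) = (1 - r) ^ (p - 2) * (1 - r) := by
    rw [← Real.rpow_add_one (by linarith)]; ring_nf
  have e3 : r ^ (1 - p) = r ^ (-p) * r := by
    rw [← Real.rpow_add_one hr.ne']; ring_nf
  have e4 : p - 1 - 1 = p - 2 := by ring
  have e5 : 1 - p - 1 = -p := by ring
  simp only [Pi.sub_apply, e4, e5, e1, e2, e3]
  ring

theorem two_le_hannerAlpha {p r : ℝ} (hp : 2 ≤ p) (hr : 0 ≤ r) (hr1 : r ≤ 1) :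
    2 ≤ hannerAlpha p r := by
  have h1 := one_add_mul_self_le_rpow_one_add (s := r) (by linarith) (p := p - 1) (by linarith)
  have h2 := one_add_mul_self_le_rpow_one_add (s := -r) (by linarith) (p := p - 1) (by linarith)
  rw [← sub_eq_add_neg] at h2
  rw [hannerAlpha]
  linarith

theorem hannerAlpha_le_hannerBeta {p r : ℝ} (hp : 2 ≤ p) (hr : 0 < r) (hr1 : r ≤ 1) :
    hannerAlpha p r ≤ hannerBeta p r := by
  have h1 := Real.add_rpow_le_rpow_add (zero_le_one) hr.le (p := p - 1) (by linarith)
  have h2 := Real.add_rpow_le_rpow_add (sub_nonneg.2 hr1) hr.le (p := p - 1) (by linarith)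
  simp only [sub_add_cancel, Real.one_rpow] at h1 h2
  have h3 : 0 < r ^ (p - 1) := Real.rpow_pos_of_pos hr _
  have h4 : 0 ≤ (1 - r) ^ (p - 1) := Real.rpow_nonneg (sub_nonneg.2 hr1) _
  have h5 : r ^ (1 - p) = (r ^ (p - 1))⁻¹ := by rw [← Real.rpow_neg hr.le]; ring_nf
  rw [hannerAlpha, hannerBeta, h5, ← div_eq_mul_inv, le_div_iff₀ h3]
  nlinarith [mul_le_mul h1 (le_sub_iff_add_le.2 h2) h4 (by positivity)]

theorem one_add_rpow_add_one_sub_rpow_le_s5 {p r R : ℝ} (hp : 2 ≤ p) (hr : 0 < r) (hr1 : r ≤ 1)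
    (hR : 0 ≤ R) (hR1 : R ≤ 1) :
    (1 + R) ^ p + (1 - R) ^ p ≤ hannerAlpha p r + hannerBeta p r * R ^ p := by
  rcases hR.eq_or_lt with rfl | hR
  · have h := two_le_hannerAlpha hp hr.le hr1
    rw [Real.zero_rpow (by linarith)]
    norm_num
    exact h
  rw [← hannerAlpha_add_hannerBeta_mul_rpow_self hR hR1 hp]
  have hcont : ContinuousOn (fun s => hannerAlpha p s + hannerBeta p s * R ^ p) (Set.Ioi 0) := by
    unfold hannerAlpha hannerBeta
    intro s hs
    have hs : s ≠ 0 := (Set.mem_Ioi.1 hs).ne'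
    have h1 : ContinuousAt (fun s : ℝ => (1 + s) ^ (p - 1)) s :=
      (by fun_prop : ContinuousAt (fun s : ℝ => 1 + s) s).rpow_const (Or.inr (by linarith))
    have h2 : ContinuousAt (fun s : ℝ => (1 - s) ^ (p - 1)) s :=
      (by fun_prop : ContinuousAt (fun s : ℝ => 1 - s) s).rpow_const (Or.inr (by linarith))
    have h3 : ContinuousAt (fun s : ℝ => s ^ (1 - p)) s :=
      continuousAt_id.rpow_const (Or.inl hs)
    exact ((h1.add h2).add (((h1.sub h2).mul h3).mul_const _)).continuousWithinAt
  have hbracket {s : ℝ} (hs : 0 < s) (hs1 : s < 1) :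
      0 ≤ (p - 1) * ((1 + s) ^ (p - 2) - (1 - s) ^ (p - 2)) :=
    mul_nonneg (by linarith) (sub_nonneg.2
      (Real.rpow_le_rpow (by linarith) (by linarith) (by linarith)))
  have hquot {s : ℝ} (hs : 0 < s) : R ^ p * s ^ (-p) = R ^ p / s ^ p := by
    rw [Real.rpow_neg hs.le, div_eq_mul_inv]
  rcases le_total r R with h | h
  · refine antitoneOn_of_hasDerivWithinAt_nonpos (convex_Icc r R)
      (hcont.mono fun s hs => hr.trans_le hs.1)
      (f' := fun s => (p - 1) * ((1 + s) ^ (p - 2) - (1 - s) ^ (p - 2)) *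
        (1 - R ^ p * s ^ (-p))) ?_ ?_ (Set.left_mem_Icc.2 h) (Set.right_mem_Icc.2 h) h
    · intro s hs
      rw [interior_Icc] at hs
      exact (hasDerivAt_hannerAlpha_add_hannerBeta_mul R (hr.trans hs.1)
        (hs.2.trans_le hR1)).hasDerivWithinAt
    · intro s hs
      rw [interior_Icc] at hs
      have hs0 := hr.trans hs.1
      refine mul_nonpos_of_nonneg_of_nonpos (hbracket hs0 (hs.2.trans_le hR1)) ?_
      rw [hquot hs0, sub_nonpos, one_le_div (Real.rpow_pos_of_pos hs0 _)]
      exact Real.rpow_le_rpow hs0.le hs.2.le (by linarith)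
  · refine monotoneOn_of_hasDerivWithinAt_nonneg (convex_Icc R r)
      (hcont.mono fun s hs => hR.trans_le hs.1)
      (f' := fun s => (p - 1) * ((1 + s) ^ (p - 2) - (1 - s) ^ (p - 2)) *
        (1 - R ^ p * s ^ (-p))) ?_ ?_ (Set.left_mem_Icc.2 h) (Set.right_mem_Icc.2 h) h
    · intro s hs
      rw [interior_Icc] at hs
      exact (hasDerivAt_hannerAlpha_add_hannerBeta_mul R (hR.trans hs.1)
        (hs.2.trans_le hr1)).hasDerivWithinAt
    · intro s hs
      rw [interior_Icc] at hs
      have hs0 := hR.trans hs.1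
      refine mul_nonneg (hbracket hs0 (hs.2.trans_le hr1)) ?_
      rw [hquot hs0, sub_nonneg, div_le_one (Real.rpow_pos_of_pos hs0 _)]
      exact Real.rpow_le_rpow hR.le hs.1.le (by linarith)

theorem add_rpow_add_sub_rpow_le_of_le {p r a b : ℝ} (hp : 2 ≤ p) (hr : 0 < r) (hr1 : r ≤ 1)
    (hb : 0 ≤ b) (hba : b ≤ a) :
    (a + b) ^ p + (a - b) ^ p ≤ hannerAlpha p r * a ^ p + hannerBeta p r * b ^ p := by
  rcases (hb.trans hba).eq_or_lt with rfl | ha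
  · obtain rfl : b = 0 := le_antisymm hba hb
    simp [Real.zero_rpow (by linarith : p ≠ 0)]
  obtain ⟨R, rfl⟩ : ∃ R, b = a * R := ⟨b / a, by field_simp⟩
  have hR : 0 ≤ R := nonneg_of_mul_nonneg_right hb ha
  have hR1 : R ≤ 1 := by nlinarith
  have h := mul_le_mul_of_nonneg_left
    (one_add_rpow_add_one_sub_rpow_le_s5 hp hr hr1 hR hR1) (Real.rpow_nonneg ha.le p)
  rw [show a + a * R = a * (1 + R) by ring, show a - a * R = a * (1 - R) by ring,
    Real.mul_rpow ha.le (by linarith), Real.mul_rpow ha.le (by linarith), Real.mul_rpow ha.le hR]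
  linarith

theorem abs_add_rpow_add_abs_sub_rpow_le_s5 {p r : ℝ} (hp : 2 ≤ p) (hr : 0 < r) (hr1 : r ≤ 1)
    (x y : ℝ) :
    |x + y| ^ p + |x - y| ^ p ≤ hannerAlpha p r * |x| ^ p + hannerBeta p r * |y| ^ p := by
  have key : |x + y| ^ p + |x - y| ^ p = (|x| + |y|) ^ p + |(|x| - |y|)| ^ p := by
    rcases abs_cases x with ⟨hx, hx'⟩ | ⟨hx, hx'⟩ <;> rcases abs_cases y with ⟨hy, hy'⟩ | ⟨hy, hy'⟩ <;>
      rw [hx, hy]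
    · rw [abs_of_nonneg (by linarith : 0 ≤ x + y)]
    · rw [abs_of_nonneg (by linarith : 0 ≤ x - y), sub_neg_eq_add, ← sub_eq_add_neg, add_comm]
    · rw [abs_of_nonpos (by linarith : x - y ≤ 0), ← abs_neg (x + y), add_comm]
      ring_nf
    · rw [abs_of_nonpos (by linarith : x + y ≤ 0), ← abs_neg (x - y)]
      ring_nf
  rw [key]
  rcases le_total |y| |x| with h | h
  · rw [abs_of_nonneg (sub_nonneg.2 h)]
    exact add_rpow_add_sub_rpow_le_of_le hp hr hr1 (abs_nonneg y) h
  · rw [abs_of_nonpos (sub_nonpos.2 h), neg_sub, add_comm |x|]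
    refine (add_rpow_add_sub_rpow_le_of_le hp hr hr1 (abs_nonneg x) h).trans ?_
    have h1 := hannerAlpha_le_hannerBeta hp hr hr1
    have h2 := Real.rpow_le_rpow (abs_nonneg x) h (by linarith : 0 ≤ p)
    nlinarith [mul_nonneg (sub_nonneg.2 h1) (sub_nonneg.2 h2)]

theorem MeasureTheory.Lp.norm_rpow_eq_integral {X : Type*} [MeasurableSpace X] {μ : Measure X}
    {E : Type*} [NormedAddCommGroup E] {p : ℝ} (hp : 0 < p) (f : Lp E (ENNReal.ofReal p) μ) :
    ‖f‖ ^ p = ∫ x, ‖f x‖ ^ p ∂μ := by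
  have h0 : 0 ≤ ∫ x, ‖f x‖ ^ p ∂μ := integral_nonneg fun x => by positivity
  rw [Lp.norm_def, (Lp.memLp f).eLpNorm_eq_integral_rpow_norm (by simpa using hp)
    ENNReal.ofReal_ne_top, ENNReal.toReal_ofReal hp.le,
    ENNReal.toReal_ofReal (by positivity), Real.rpow_inv_rpow h0 hp.ne']

theorem MeasureTheory.Lp.integrable_norm_rpow {X : Type*} [MeasurableSpace X] {μ : Measure X}
    {E : Type*} [NormedAddCommGroup E] {p : ℝ} (hp : 0 < p) (f : Lp E (ENNReal.ofReal p) μ) :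
    Integrable (fun x => ‖f x‖ ^ p) μ := by
  have h := (Lp.memLp f).integrable_norm_rpow (by simpa using hp) ENNReal.ofReal_ne_top
  rwa [ENNReal.toReal_ofReal hp.le] at h

theorem norm_add_rpow_add_norm_sub_rpow_le {X : Type*} [MeasurableSpace X] {μ : Measure X}
    {p r : ℝ} (hp : 2 ≤ p) (hr : 0 < r) (hr1 : r ≤ 1) (φ ψ : Lp ℝ (ENNReal.ofReal p) μ) :
    ‖φ + ψ‖ ^ p + ‖φ - ψ‖ ^ p ≤ hannerAlpha p r * ‖φ‖ ^ p + hannerBeta p r * ‖ψ‖ ^ p := by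
  have hp0 : 0 < p := by linarith
  have hint := fun f : Lp ℝ (ENNReal.ofReal p) μ => Lp.integrable_norm_rpow hp0 f
  simp only [Lp.norm_rpow_eq_integral hp0]
  rw [← integral_add (hint _) (hint _), ← integral_const_mul, ← integral_const_mul,
    ← integral_add ((hint _).const_mul _) ((hint _).const_mul _)]
  refine integral_mono_ae ((hint _).add (hint _))
    (((hint _).const_mul _).add ((hint _).const_mul _)) ?_
  filter_upwards [Lp.coeFn_add φ ψ, Lp.coeFn_sub φ ψ] with x h1 h2
  simp only [h1, h2, Pi.add_apply, Pi.sub_apply, Real.norm_eq_abs]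
  exact abs_add_rpow_add_abs_sub_rpow_le_s5 hp hr hr1 _ _

theorem hanner_Lp_of_norm_le {X : Type*} [MeasurableSpace X] {μ : Measure X}
    {p : ℝ} (hp : 2 ≤ p) {φ ψ : Lp ℝ (ENNReal.ofReal p) μ} (h : ‖ψ‖ ≤ ‖φ‖) :
    ‖φ + ψ‖ ^ p + ‖φ - ψ‖ ^ p ≤ (‖φ‖ + ‖ψ‖) ^ p + |‖φ‖ - ‖ψ‖| ^ p := by
  have : Fact (1 ≤ ENNReal.ofReal p) := ⟨by rw [ENNReal.one_le_ofReal]; linarith⟩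
  rcases (norm_nonneg ψ).eq_or_lt with h0 | h0
  · obtain rfl : ψ = 0 := norm_eq_zero.1 h0.symm
    simp
  have ha : 0 < ‖φ‖ := h0.trans_le h
  have hr : 0 < ‖ψ‖ / ‖φ‖ := div_pos h0 ha
  have hr1 : ‖ψ‖ / ‖φ‖ ≤ 1 := (div_le_one ha).2 h
  refine (norm_add_rpow_add_norm_sub_rpow_le hp hr hr1 φ ψ).trans_eq ?_
  have hψ : ‖ψ‖ = ‖φ‖ * (‖ψ‖ / ‖φ‖) := by field_simp
  generalize ‖ψ‖ / ‖φ‖ = r at *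
  rw [abs_of_nonneg (sub_nonneg.2 h), hψ, show ‖φ‖ + ‖φ‖ * r = ‖φ‖ * (1 + r) by ring,
    show ‖φ‖ - ‖φ‖ * r = ‖φ‖ * (1 - r) by ring, Real.mul_rpow ha.le hr.le,
    Real.mul_rpow ha.le (by linarith), Real.mul_rpow ha.le (by linarith), ← mul_add,
    ← hannerAlpha_add_hannerBeta_mul_rpow_self hr hr1 hp]
  ring

theorem hanner_Lp_ge_two {X : Type*} [MeasurableSpace X] (μ : Measure X)
    (p : ℝ) (hp : 2 ≤ p) (φ ψ : Lp ℝ (ENNReal.ofReal p) μ) :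
    ‖φ + ψ‖ ^ p + ‖φ - ψ‖ ^ p ≤ (‖φ‖ + ‖ψ‖) ^ p + |‖φ‖ - ‖ψ‖| ^ p := by
  rcases le_total ‖ψ‖ ‖φ‖ with h | h
  · exact hanner_Lp_of_norm_le hp h
  · rw [add_comm φ, add_comm ‖φ‖, abs_sub_comm, ← neg_sub ψ φ, Lp.norm_neg]
    exact hanner_Lp_of_norm_le hp h
end
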